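/- Let α > 0 and let k ≥ 1 be an integer with 2k < 2 + α, and set λ = 2 − 8k²/(2+α)², δ_λ = (4 − λ − 2√(4 − 2λ))/λ. Then the function ψ_k : [0,1] → ℝ defined by ψ_k(r) = r^k · ( 2(2+α)(1 − r^{2(2+α)}) + 4k(1 − r^{2+α})² ) / ( (2(2+α)² − 8k²)(1 − r^{2+α})² + 8(2+α)²·r^{2+α} ) satisfies: ψ_k(0) = 0 = ψ_k(1), ψ_k(r) > 0 for r ∈ (0,1), ∫₀¹ ( r·ψ_k'(r)² + ψ_k(r)²/r ) dr < ∞, and −ψ_k''(r) − (1/r)ψ_k'(r) + (k²/r²)ψ_k(r) = ((2+α)/2)² · r^α · (8δ_λ/(δ_λ + r^{2+α})²) · ψ_k(r) for all r ∈ (0,1). -/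

import Mathlib

open Set MeasureTheory

lemma aux_pow (n : ℕ) (r : ℝ) (hr : 0 < r) :
    HasDerivAt (fun x : ℝ => x ^ n) (n * r ^ n / r) r := by
  refine (hasDerivAt_pow n r).congr_deriv ?_
  rcases n with _ | n
  · simp
  · simp only [Nat.add_sub_cancel]; field_simp; ring

lemma aux_rpow (b : ℝ) (r : ℝ) (hr : 0 < r) :
    HasDerivAt (fun x : ℝ => x ^ b) (b * r ^ b / r) r := by
  refine (Real.hasDerivAt_rpow_const (p := b) (Or.inl hr.ne')).congr_deriv ?_
  rw [Real.rpow_sub_one hr.ne']; ring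

lemma aux_d1 (b : ℝ) (k : ℕ) (hb : 2 * (k : ℝ) < b) (r : ℝ) (hr : 0 < r) :
    HasDerivAt (fun x : ℝ => x ^ k * (1 - x ^ b) / ((b + 2 * k) * x ^ b + (b - 2 * k)))
      (r ^ k * (k * (1 - r ^ b) / ((b + 2 * k) * r ^ b + (b - 2 * k))
        - 2 * b ^ 2 * r ^ b / ((b + 2 * k) * r ^ b + (b - 2 * k)) ^ 2) / r) r := by
  have hk : (0 : ℝ) ≤ k := Nat.cast_nonneg k
  have hs : 0 < r ^ b := Real.rpow_pos_of_pos hr b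
  have hD : 0 < (b + 2 * k) * r ^ b + (b - 2 * k) := by
    have : 0 < (b + 2 * k) * r ^ b := mul_pos (by linarith) hs
    linarith
  have h1 := aux_pow k r hr
  have h2 := aux_rpow b r hr
  refine ((h1.mul (h2.const_sub 1)).div ((h2.const_mul (b + 2 * k)).add_const (b - 2 * k))
    hD.ne').congr_deriv ?_
  simp only [Pi.mul_apply]
  generalize hP : r ^ k = P at *
  generalize r ^ b = s at *
  have hD' := hD.ne'
  field_simp
  ring

lemma aux_d2 (b : ℝ) (k : ℕ) (hb : 2 * (k : ℝ) < b) (r : ℝ) (hr : 0 < r) :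
    HasDerivAt (fun r : ℝ => (r ^ k * (k * (1 - r ^ b) / ((b + 2 * k) * r ^ b + (b - 2 * k))
        - 2 * b ^ 2 * r ^ b / ((b + 2 * k) * r ^ b + (b - 2 * k)) ^ 2) / r))
      ((k ^ 2 * (r ^ k * (1 - r ^ b) / ((b + 2 * k) * r ^ b + (b - 2 * k)))
       - 2 * b ^ 2 * r ^ b * ((b - 2 * k) * (b + 2 * k)) /
          ((b + 2 * k) * r ^ b + (b - 2 * k)) ^ 2 *
          (r ^ k * (1 - r ^ b) / ((b + 2 * k) * r ^ b + (b - 2 * k)))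
       - (r ^ k * (k * (1 - r ^ b) / ((b + 2 * k) * r ^ b + (b - 2 * k))
        - 2 * b ^ 2 * r ^ b / ((b + 2 * k) * r ^ b + (b - 2 * k)) ^ 2))) / r ^ 2) r := by
  have hk : (0 : ℝ) ≤ k := Nat.cast_nonneg k
  have hs : 0 < r ^ b := Real.rpow_pos_of_pos hr b
  have hD : 0 < (b + 2 * k) * r ^ b + (b - 2 * k) := by
    have : 0 < (b + 2 * k) * r ^ b := mul_pos (by linarith) hs
    linarith
  have h1 := aux_pow k r hr
  have h2 := aux_rpow b r hr
  have h3 := (h2.const_mul (b + 2 * k)).add_const (b - 2 * k)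
  have h4 := ((h2.const_sub 1).const_mul (k : ℝ)).div h3 hD.ne'
  have h5 := (h2.const_mul (2 * b ^ 2)).div (h3.pow 2) (pow_ne_zero 2 hD.ne')
  have h6 := (h1.mul (h4.sub h5)).div (hasDerivAt_id r) hr.ne'
  refine h6.congr_deriv ?_
  clear h1 h2 h3 h4 h5 h6
  simp only [Pi.mul_apply, Pi.sub_apply, Pi.div_apply, Pi.pow_apply, id]
  generalize hP : r ^ k = P at *
  generalize r ^ b = s at *
  generalize hDD : (b + 2 * k) * s + (b - 2 * k) = D at *
  have hD' := hD.ne'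
  norm_num
  field_simp
  rw [← hDD]
  ring

/-- at the degeneracy value `λ = 2 − 8k²/(2+α)²`, the explicit function
`ψ_k` is a positive finite-energy solution of the `k`-th mode of the linearized
equation at the non-minimal radial solution, vanishing at `0` and `1`. -/
theorem stmt_10 (α : ℝ) (hα : 0 < α) (k : ℕ) (hk : 1 ≤ k)
    (hkα : 2 * (k : ℝ) < 2 + α)
    (lam : ℝ) (hlam : lam = 2 - 8 * (k : ℝ) ^ 2 / (2 + α) ^ 2)
    (δ : ℝ) (hδ : δ = (4 - lam - 2 * Real.sqrt (4 - 2 * lam)) / lam)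
    (ψ : ℝ → ℝ)
    (hψ : ∀ r, ψ r = r ^ (k : ℕ) *
      (2 * (2 + α) * (1 - r ^ (2 * (2 + α))) + 4 * (k : ℝ) * (1 - r ^ (2 + α)) ^ 2) /
      ((2 * (2 + α) ^ 2 - 8 * (k : ℝ) ^ 2) * (1 - r ^ (2 + α)) ^ 2
        + 8 * (2 + α) ^ 2 * r ^ (2 + α))) :
    ψ 0 = 0 ∧ ψ 1 = 0 ∧
    (∀ r ∈ Ioo (0 : ℝ) 1, 0 < ψ r) ∧
    IntegrableOn (fun r => r * (deriv ψ r) ^ 2 + (ψ r) ^ 2 / r) (Ioo 0 1) ∧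
    (∀ r ∈ Ioo (0 : ℝ) 1, DifferentiableAt ℝ ψ r ∧ DifferentiableAt ℝ (deriv ψ) r ∧
      -deriv (deriv ψ) r - (1 / r) * deriv ψ r + ((k : ℝ) ^ 2 / r ^ 2) * ψ r
        = ((2 + α) / 2) ^ 2 * r ^ α * (8 * δ / (δ + r ^ (2 + α)) ^ 2) * ψ r) := by
  have hK : (1 : ℝ) ≤ k := by exact_mod_cast hk
  obtain ⟨b, rfl⟩ : ∃ b, α = b - 2 := ⟨α + 2, by ring⟩
  have e2 : 2 + (b - 2) = b := by ring
  simp only [e2] at *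
  have hb : 0 < b := by linarith
  have hm : 0 < b - 2 * k := by linarith
  have hp : 0 < b + 2 * k := by linarith
  have hδ' : δ = (b - 2 * k) / (b + 2 * k) := by
    have h0 : Real.sqrt (4 - 2 * lam) = 4 * k / b := by
      rw [show 4 - 2 * lam = (4 * k / b) ^ 2 by rw [hlam]; field_simp; ring]
      exact Real.sqrt_sq (by positivity)
    have hl : lam = 2 * ((b - 2 * k) * (b + 2 * k)) / b ^ 2 := by
      rw [hlam]; field_simp; ring
    rw [hδ, h0, hl]
    field_simp
    ring
  have hDp : ∀ r : ℝ, 0 ≤ r → 0 < (b + 2 * k) * r ^ b + (b - 2 * k) := by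
    intro r hr
    have : 0 ≤ (b + 2 * k) * r ^ b := mul_nonneg hp.le (Real.rpow_nonneg hr b)
    linarith
  have key : ∀ r : ℝ, 0 ≤ r →
      ψ r = r ^ k * (1 - r ^ b) / ((b + 2 * k) * r ^ b + (b - 2 * k)) := by
    intro r hr
    have hs := Real.rpow_nonneg hr b
    have hD := hDp r hr
    rw [hψ r, show r ^ (2 * b) = (r ^ b) ^ 2 by
      rw [mul_comm, Real.rpow_mul hr, Real.rpow_two]]
    generalize r ^ b = s at *
    have hE : (0:ℝ) < (b - 2 * k) * s + (b + 2 * k) := by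
      have := mul_nonneg hm.le hs
      linarith
    rw [show (2 * b ^ 2 - 8 * (k:ℝ) ^ 2) * (1 - s) ^ 2 + 8 * b ^ 2 * s
      = 2 * (((b + 2 * k) * s + (b - 2 * k)) * ((b - 2 * k) * s + (b + 2 * k))) by ring,
      show 2 * b * (1 - s ^ 2) + 4 * (k:ℝ) * (1 - s) ^ 2
        = 2 * ((1 - s) * ((b - 2 * k) * s + (b + 2 * k))) by ring]
    have hD' := hD.ne'
    have hE' := hE.ne'
    field_simp
  have d1 : ∀ r : ℝ, 0 < r → HasDerivAt ψ
      (r ^ k * (k * (1 - r ^ b) / ((b + 2 * k) * r ^ b + (b - 2 * k))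
        - 2 * b ^ 2 * r ^ b / ((b + 2 * k) * r ^ b + (b - 2 * k)) ^ 2) / r) r := by
    intro r hr
    refine (aux_d1 b k hkα r hr).congr_of_eventuallyEq ?_
    filter_upwards [lt_mem_nhds hr] with x hx using key x hx.le
  have d2 := fun (r : ℝ) (hr : 0 < r) => (aux_d2 b k hkα r hr).congr_of_eventuallyEq
    (f₁ := deriv ψ) (by filter_upwards [lt_mem_nhds hr] with x hx using (d1 x hx).deriv)
  refine ⟨?_, ?_, ?_, ?_, ?_⟩
  · rw [key 0 le_rfl, zero_pow (by omega)]; simp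
  · rw [key 1 zero_le_one]; simp
  · intro r hr
    rw [key r hr.1.le]
    have h1 : r ^ b < 1 := Real.rpow_lt_one hr.1.le hr.2 hb
    exact div_pos (mul_pos (pow_pos hr.1 k) (by linarith)) (hDp r hr.1.le)
  · obtain ⟨m, rfl⟩ : ∃ m, k = m + 1 := ⟨k - 1, by omega⟩
    generalize hKK : ((m + 1 : ℕ) : ℝ) = K at *
    have hc : ContinuousOn (fun r : ℝ => r ^ (2 * m + 1) *
        ((K * (1 - r ^ b) / ((b + 2 * K) * r ^ b + (b - 2 * K))
        - 2 * b ^ 2 * r ^ b / ((b + 2 * K) * r ^ b + (b - 2 * K)) ^ 2) ^ 2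
        + ((1 - r ^ b) / ((b + 2 * K) * r ^ b + (b - 2 * K))) ^ 2)) (Icc 0 1) := by
      have hs : ContinuousOn (fun r : ℝ => r ^ b) (Icc 0 1) :=
        (Real.continuous_rpow_const hb.le).continuousOn
      have hD : ContinuousOn (fun r : ℝ => (b + 2 * K) * r ^ b + (b - 2 * K)) (Icc 0 1) :=
        (continuousOn_const.mul hs).add continuousOn_const
      have hne : ∀ r ∈ Icc (0:ℝ) 1, (b + 2 * K) * r ^ b + (b - 2 * K) ≠ 0 :=
        fun r hr => (hDp r hr.1).ne'
      have hne2 : ∀ r ∈ Icc (0:ℝ) 1, ((b + 2 * K) * r ^ b + (b - 2 * K)) ^ 2 ≠ 0 :=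
        fun r hr => pow_ne_zero 2 (hne r hr)
      have h1 := continuousOn_const (c := (1:ℝ)).sub hs
      exact (continuousOn_id.pow _).mul
        (((((continuousOn_const.mul h1).div hD hne).sub
          ((continuousOn_const.mul hs).div (hD.pow 2) hne2)).pow 2).add ((h1.div hD hne).pow 2))
    have hi := (hc.integrableOn_compact (μ := volume) isCompact_Icc).mono_set
      (Ioo_subset_Icc_self (a := (0:ℝ)) (b := 1))
    refine hi.congr_fun ?_ measurableSet_Ioo
    intro r hr
    have hr0 := hr.1.ne'
    simp only [(d1 r hr.1).deriv, key r hr.1.le]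
    generalize K * (1 - r ^ b) / ((b + 2 * K) * r ^ b + (b - 2 * K))
        - 2 * b ^ 2 * r ^ b / ((b + 2 * K) * r ^ b + (b - 2 * K)) ^ 2 = A
    rw [mul_div_assoc (r ^ (m + 1)) (1 - r ^ b)]
    generalize (1 - r ^ b) / ((b + 2 * K) * r ^ b + (b - 2 * K)) = B
    field_simp
    ring
  · intro r hr
    refine ⟨(d1 r hr.1).differentiableAt, (d2 r hr.1).differentiableAt, ?_⟩
    have hr0 := hr.1.ne'
    have hD := (hDp r hr.1.le).ne'
    rw [(d2 r hr.1).deriv, (d1 r hr.1).deriv, key r hr.1.le, hδ',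
      show r ^ (b - 2) = r ^ b / r ^ 2 by rw [Real.rpow_sub hr.1, Real.rpow_two]]
    generalize r ^ k = P
    generalize r ^ b = s at *
    rw [show (b - 2 * k) / (b + 2 * k) + s = ((b + 2 * k) * s + (b - 2 * k)) / (b + 2 * k) by
      field_simp; ring]
    generalize hDD : (b + 2 * k) * s + (b - 2 * k) = D at *
    field_simp
    ring
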